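/- arXiv:2109.00655 — 3 statements merged into one kernel-verified Lean document; each statement's English description precedes it below -/
import Mathlib

section
/- Hyperoctahedral quadratic form identity. Let d ≥ 2 be an integer and u₁,…,u_{d+2} ∈ ℝ. For i = 0,…,d set xᵢ := (u₁ + ⋯ + u_{i+1})/(i+1). Then −Σ_{i=0}^{d−1} ((i+1)(i+2)/2)·(xᵢ − xᵢ₊₁)² − ((d+1)/2)·(x_d − u_{d+2})² + u_{d+2}² = u_{d+2}² − (1/2)·Σ_{i=1}^{d+1} (uᵢ − u_{d+2})². -/
noncomputable section

open Finset

/-- The sum of squared deviations from `c`, decomposed along the successive averages `x` of `v`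
(which are characterised by their recurrence). -/
theorem sum_sq_sub_eq_sum_sq_sub_average (c : ℝ) (n : ℕ) (v x : Fin (n + 1) → ℝ) (h0 : x 0 = v 0)
    (hs : ∀ i : Fin n,
      ((i : ℕ) + 2 : ℝ) * x i.succ = ((i : ℕ) + 1) * x i.castSucc + v i.succ) :
    ∑ i, (v i - c) ^ 2 =
      ∑ i : Fin n, (((i : ℕ) + 1) * ((i : ℕ) + 2) : ℝ) * (x i.castSucc - x i.succ) ^ 2 +
        (n + 1) * (x (Fin.last n) - c) ^ 2 := by
  induction n with
  | zero => simp [h0]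
  | succ n ih =>
    have key := ih (fun i => v i.castSucc) (fun i => x i.castSucc) (by simpa using h0)
      (fun i => by simpa using hs i.castSucc)
    have hl := hs (Fin.last n)
    rw [Fin.sum_univ_castSucc, key, Fin.sum_univ_castSucc (n := n)]
    simp only [Fin.val_castSucc, Fin.val_last, Fin.succ_last, Fin.succ_castSucc] at hl ⊢
    push_cast
    have hv : v (Fin.last (n + 1)) =
        (n + 2) * x (Fin.last (n + 1)) - (n + 1) * x (Fin.last n).castSucc := by linarith
    rw [hv]
    ring

/-- Enlarging an initial segment of a finite sum by one index. -/
theorem sum_filter_val_le_succ (n : ℕ) (u : Fin n → ℝ) (k : ℕ) (hk : k + 1 < n) :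
    ∑ j ∈ Finset.univ.filter (fun j : Fin n => (j : ℕ) ≤ k + 1), u j =
      ∑ j ∈ Finset.univ.filter (fun j : Fin n => (j : ℕ) ≤ k), u j + u ⟨k + 1, hk⟩ := by
  have h : Finset.univ.filter (fun j : Fin n => (j : ℕ) ≤ k + 1) =
      insert ⟨k + 1, hk⟩ (Finset.univ.filter (fun j : Fin n => (j : ℕ) ≤ k)) := by
    ext j
    simp only [Finset.mem_filter, Finset.mem_univ, true_and, Finset.mem_insert, Fin.ext_iff]
    omega
  rw [h, Finset.sum_insert (by simp), add_comm]

/-- Hyperoctahedral quadratic form identity: the flag quadratic form of the regular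
(d+1)-cross-polytope, evaluated at the partial averages x₀,…,x_d of u₁,…,u_{d+1} with last
argument u_{d+2}, equals the hyperoctahedral quadratic form 𝔒_{d+1}(u₁,…,u_{d+2}). -/
theorem hyperoctahedral_quadratic_form_identity (d : ℕ) (hd : 2 ≤ d)
    (u : Fin (d + 2) → ℝ) (x : Fin (d + 1) → ℝ)
    (hx : ∀ i : Fin (d + 1),
      x i = (∑ j ∈ Finset.univ.filter fun j : Fin (d + 2) => (j : ℕ) ≤ (i : ℕ), u j) /
        ((i : ℕ) + 1)) :
    -(∑ i : Fin d,
        ((((i : ℕ) + 1) * ((i : ℕ) + 2) / 2 : ℝ)) * (x i.castSucc - x i.succ) ^ 2) -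
      ((d + 1 : ℝ) / 2) * (x (Fin.last d) - u (Fin.last (d + 1))) ^ 2 +
      (u (Fin.last (d + 1))) ^ 2 =
    (u (Fin.last (d + 1))) ^ 2 -
      (1 / 2 : ℝ) * ∑ i : Fin (d + 1), (u i.castSucc - u (Fin.last (d + 1))) ^ 2 := by
  have h0 : x 0 = u (Fin.castSucc 0) := by
    have h : Finset.univ.filter (fun j : Fin (d + 2) => (j : ℕ) ≤ ((0 : Fin (d + 1)) : ℕ)) =
        {0} := by
      ext j
      rw [Finset.mem_filter, Finset.mem_singleton, Fin.ext_iff]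
      simp
    rw [hx, h]
    simp
  have hs (i : Fin d) : ((i : ℕ) + 2 : ℝ) * x i.succ =
      ((i : ℕ) + 1) * x i.castSucc + u i.succ.castSucc := by
    have h := sum_filter_val_le_succ (d + 2) u i (by omega)
    have h1 : ((i : ℕ) + 1 : ℝ) ≠ 0 := by positivity
    have h2 : ((i : ℕ) + 2 : ℝ) ≠ 0 := by positivity
    have h3 : ((i : ℕ) + 1 + 1 : ℝ) = (i : ℕ) + 2 := by ring
    rw [hx, hx]
    simp only [Fin.val_succ, Fin.val_castSucc]
    push_cast
    rw [h3, mul_div_cancel₀ _ h2, mul_div_cancel₀ _ h1, h]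
    rfl
  rw [sum_sq_sub_eq_sum_sq_sub_average (u (Fin.last (d + 1))) d (fun i => u i.castSucc) x h0 hs,
    mul_add, Finset.mul_sum]
  have h (i : Fin d) :
      (1 / 2 : ℝ) * ((((i : ℕ) + 1) * ((i : ℕ) + 2) : ℝ) * (x i.castSucc - x i.succ) ^ 2) =
        ((((i : ℕ) + 1) * ((i : ℕ) + 2) / 2 : ℝ)) * (x i.castSucc - x i.succ) ^ 2 := by ring
  simp only [h]
  ring
end
end

section
/- Octahedral glueing relation. Let y be an octahedral disk packing in ℝ⁴, set a := κ(y₁), b := κ(y₂), c := κ(y₃) (the curvatures of three pairwise tangent disks) and κ_O := (κ(y₁) + κ(y₋₁))/2. Then (κ_O − (a + b + c))² = 2(ab + bc + ca); equivalently, κ_O = a + b + c ± √(2(ab + bc + ca)). -/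
noncomputable section

/-- Inversive product on ℝ⁴. -/
def Q2 (a b : Fin 4 → ℝ) : ℝ := a 0 * b 0 + a 1 * b 1 + a 2 * b 2 - a 3 * b 3

/-- Curvature of a disk in inversive coordinates. -/
def curv2 (a : Fin 4 → ℝ) : ℝ := a 3 - a 2

/-- An octahedral disk packing, indexed by `{±1,±2,±3}` (here `Fin 3 × Bool`,
with negation flipping the boolean; `true` stands for the positive indices). -/
def IsOctaPacking (y : Fin 3 × Bool → (Fin 4 → ℝ)) : Prop :=
  (∀ k, Q2 (y k) (y k) = 1) ∧
  (∀ k l, l ≠ k → l ≠ (k.1, !k.2) → Q2 (y k) (y l) = -1) ∧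
  (∀ k, Q2 (y k) (y (k.1, !k.2)) = -3)

/-- Parseval's identity for `Q2`, applied to the isotropic vector `(0, 0, 1, 1)` that
represents the curvature. -/
theorem sum_curv2_sq_div_eq_zero {e : Fin 4 → Fin 4 → ℝ} {d : Fin 4 → ℝ}
    (hd : ∀ i, d i ≠ 0) (he : ∀ i j, Q2 (e i) (e j) = if i = j then d i else 0) :
    ∑ i, curv2 (e i) ^ 2 / d i = 0 := by
  let s : Fin 4 → ℝ := ![1, 1, 1, -1]
  let A : Matrix (Fin 4) (Fin 4) ℝ := Matrix.of e
  let B : Matrix (Fin 4) (Fin 4) ℝ := Matrix.of fun k i => s k * e i k / d i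
  have hAB : A * B = 1 := by
    ext i j
    have h : (A * B) i j = Q2 (e i) (e j) / d j := by
      simp [A, B, s, Matrix.mul_apply, Fin.sum_univ_four, Q2]
      ring
    rw [h, he, Matrix.one_apply]
    split_ifs with hij
    · subst hij
      exact div_self (hd i)
    · exact zero_div _
  have hBA : B * A = 1 := mul_eq_one_comm.mp hAB
  have h22 := congrFun₂ hBA 2 2
  have h23 := congrFun₂ hBA 2 3
  have h33 := congrFun₂ hBA 3 3
  simp [A, B, s, Matrix.mul_apply, Fin.sum_univ_four] at h22 h23 h33
  simp only [Fin.sum_univ_four, curv2]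
  linear_combination h22 - 2 * h23 - h33

/-- Octahedral glueing relation: with a, b, c the curvatures of three pairwise tangent disks
of an octahedral disk packing and κ_O the mean curvature of an antipodal pair, one has
`(κ_O − (a+b+c))² = 2(ab+bc+ca)`, i.e. `κ_O = a+b+c ± √(2(ab+bc+ca))`. -/
theorem octahedral_glueing (y : Fin 3 × Bool → (Fin 4 → ℝ)) (hy : IsOctaPacking y)
    (a b c κO : ℝ) (ha : a = curv2 (y (0, true))) (hb : b = curv2 (y (1, true)))
    (hc : c = curv2 (y (2, true)))
    (hκO : κO = (curv2 (y (0, true)) + curv2 (y (0, false))) / 2) :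
    (κO - (a + b + c)) ^ 2 = 2 * (a * b + b * c + c * a) := by
  obtain ⟨h1, h2, h3⟩ := hy
  let o : Fin 4 → ℝ := fun k => (y (0, true) k + y (0, false) k) / 2
  have h00 := h1 (0, true)
  have h11 := h1 (1, true)
  have h22 := h1 (2, true)
  have h00' := h1 (0, false)
  have hanti := h3 (0, true)
  have h01 := h2 (0, true) (1, true) (by simp) (by simp)
  have h02 := h2 (0, true) (2, true) (by simp) (by simp)
  have h12 := h2 (1, true) (2, true) (by simp) (by simp)
  have h01' := h2 (0, false) (1, true) (by simp) (by simp)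
  have h02' := h2 (0, false) (2, true) (by simp) (by simp)
  have key := sum_curv2_sq_div_eq_zero
    (e := ![y (0, true) - o, y (1, true) - o, y (2, true) - o, o]) (d := ![2, 2, 2, -1])
    (by intro i; fin_cases i <;> simp)
    (by
      simp only [Q2, Bool.not_true] at h00 h11 h22 h00' hanti h01 h02 h12 h01' h02'
      intro i j
      fin_cases i <;> fin_cases j <;> simp [Q2, o] <;> linarith)
  have ho : curv2 o = κO := by
    simp only [hκO, curv2, o]
    ring
  have hsub (v : Fin 4 → ℝ) : curv2 (v - o) = curv2 v - κO := by
    rw [← ho]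
    simp only [curv2, Pi.sub_apply]
    ring
  simp [Fin.sum_univ_four, hsub, ho, ← ha, ← hb, ← hc] at key
  linear_combination 2 * key
end
end

section
/- Soddy–Gosset theorem (Euclidean form for externally tangent balls). Let d ≥ 1 and suppose c₁,…,c_{d+2} are points of the Euclidean space ℝ^d and r₁,…,r_{d+2} are positive real numbers such that dist(cᵢ, cⱼ) = rᵢ + rⱼ for all i ≠ j (d+2 pairwise externally tangent balls with centers cᵢ and radii rᵢ). Then, with curvatures κᵢ := 1/rᵢ, one has d·Σ_{i=1}^{d+2} κᵢ² = (Σ_{i=1}^{d+2} κᵢ)². -/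
/-- More than `finrank + 1` points of a vector space satisfy a nontrivial affine relation. -/
theorem exists_affine_relation_of_finrank_succ_lt_card {ι E : Type*} [Fintype ι]
    [AddCommGroup E] [Module ℝ E] [FiniteDimensional ℝ E] (c : ι → E)
    (h : Module.finrank ℝ E + 1 < Fintype.card ι) :
    ∃ w : ι → ℝ, ∑ i, w i • c i = 0 ∧ ∑ i, w i = 0 ∧ ∃ i, w i ≠ 0 := by
  have hdep : ¬ LinearIndependent ℝ (fun i => (c i, (1 : ℝ))) := fun hli => by
    have := hli.fintype_card_le_finrank
    rw [Module.finrank_prod, Module.finrank_self] at this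
    omega
  obtain ⟨w, hw, hne⟩ := Fintype.not_linearIndependent_iff.mp hdep
  refine ⟨w, ?_, ?_, hne⟩
  · simpa [Prod.fst_sum] using congrArg Prod.fst hw
  · simpa [Prod.snd_sum] using congrArg Prod.snd hw

/-- For an affine relation `w` among points `c j`, the `w`-weighted sum of squared distances
from a point `x` to the `c j` does not depend on `x`. -/
theorem sum_mul_dist_sq_of_affine_relation {ι E : Type*} [Fintype ι] [NormedAddCommGroup E]
    [InnerProductSpace ℝ E] (c : ι → E) (w : ι → ℝ) (hc : ∑ i, w i • c i = 0)
    (hw : ∑ i, w i = 0) (x : E) :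
    ∑ j, w j * dist x (c j) ^ 2 = ∑ j, w j * ‖c j‖ ^ 2 := by
  have hinner : ∑ j, w j * inner ℝ x (c j) = 0 := by
    simpa [inner_sum, real_inner_smul_right] using congrArg (inner ℝ x) hc
  calc ∑ j, w j * dist x (c j) ^ 2
      = ∑ j, (‖x‖ ^ 2 * w j - 2 * (w j * inner ℝ x (c j)) + w j * ‖c j‖ ^ 2) := by
        refine Finset.sum_congr rfl fun j _ => ?_
        rw [dist_eq_norm, norm_sub_sq_real]
        ring
    _ = ∑ j, w j * ‖c j‖ ^ 2 := by
        rw [Finset.sum_add_distrib, Finset.sum_sub_distrib, ← Finset.mul_sum, ← Finset.mul_sum,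
          hw, hinner]
        ring

/-- An affine relation among the centers of pairwise externally tangent balls has weights that
are linear combinations of the curvature and its square. -/
theorem affine_relation_eq_of_tangent {ι E : Type*} [Fintype ι] [NormedAddCommGroup E]
    [InnerProductSpace ℝ E] (c : ι → E) (r w : ι → ℝ) (hr : ∀ i, 0 < r i)
    (htan : ∀ i j, i ≠ j → dist (c i) (c j) = r i + r j)
    (hc : ∑ i, w i • c i = 0) (hw : ∑ i, w i = 0) :
    ∃ b : ℝ, ∀ i, w i = (∑ j, w j * r j) / 2 * (1 / r i) + b * (1 / r i) ^ 2 := by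
  classical
  refine ⟨(∑ j, w j * r j ^ 2 - ∑ j, w j * ‖c j‖ ^ 2) / 4, fun i => ?_⟩
  have hexpand : ∑ j, w j * dist (c i) (c j) ^ 2
      = 2 * r i * ∑ j, w j * r j + ∑ j, w j * r j ^ 2 - 4 * r i ^ 2 * w i := by
    calc ∑ j, w j * dist (c i) (c j) ^ 2
        = ∑ j, (r i ^ 2 * w j + 2 * r i * (w j * r j) + w j * r j ^ 2
            - if i = j then 4 * r i ^ 2 * w i else 0) := by
          refine Finset.sum_congr rfl fun j _ => ?_
          split_ifs with h
          · subst h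
            rw [dist_self]
            ring
          · rw [htan i j h]
            ring
      _ = _ := by
          rw [Finset.sum_sub_distrib, Finset.sum_add_distrib, Finset.sum_add_distrib,
            ← Finset.mul_sum, ← Finset.mul_sum, hw, Finset.sum_ite_eq]
          simp
  rw [sum_mul_dist_sq_of_affine_relation c w hc hw] at hexpand
  have hri := (hr i).ne'
  field_simp
  linarith

noncomputable section

/-- Soddy–Gosset theorem (Euclidean form): if d+2 balls in ℝ^d with centers cᵢ and radii
rᵢ > 0 are pairwise externally tangent (`dist(cᵢ,cⱼ) = rᵢ + rⱼ`), then their curvatures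
κᵢ = 1/rᵢ satisfy `d·∑ κᵢ² = (∑ κᵢ)²`. -/
theorem soddy_gosset_euclidean (d : ℕ) (hd : 1 ≤ d)
    (c : Fin (d + 2) → EuclideanSpace ℝ (Fin d)) (r : Fin (d + 2) → ℝ)
    (hr : ∀ i, 0 < r i)
    (htan : ∀ i j, i ≠ j → dist (c i) (c j) = r i + r j) :
    (d : ℝ) * ∑ i : Fin (d + 2), (1 / r i) ^ 2 = (∑ i : Fin (d + 2), 1 / r i) ^ 2 := by
  obtain ⟨w, hc, hw, k, hk⟩ := exists_affine_relation_of_finrank_succ_lt_card c (by simp)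
  obtain ⟨b, hb⟩ := affine_relation_eq_of_tangent c r w hr htan hc hw
  set a := (∑ j, w j * r j) / 2 with ha
  set p := ∑ i, 1 / r i with hp
  set q := ∑ i, (1 / r i) ^ 2 with hq
  have hsum : a * p + b * q = 0 := by
    rw [hp, hq, Finset.mul_sum, Finset.mul_sum, ← Finset.sum_add_distrib, ← hw]
    exact Finset.sum_congr rfl fun i _ => (hb i).symm
  have hsum_mul : ∑ j, w j * r j = (d + 2) * a + b * p := by
    calc ∑ j, w j * r j = ∑ j, (a + b * (1 / r j)) := by
          refine Finset.sum_congr rfl fun j _ => ?_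
          have hrj := (hr j).ne'
          rw [hb j]
          field_simp
      _ = _ := by simp [Finset.sum_add_distrib, ← Finset.mul_sum, hp]
  have hlin : d * a + b * p = 0 := by linarith
  by_contra hne
  have hdet : d * q - p ^ 2 ≠ 0 := sub_ne_zero.mpr hne
  have ha0 : a = 0 := (mul_eq_zero.mp (show (d * q - p ^ 2) * a = 0 by
    linear_combination q * hlin - p * hsum)).resolve_left hdet
  have hb0 : b = 0 := (mul_eq_zero.mp (show (d * q - p ^ 2) * b = 0 by
    linear_combination d * hsum - p * hlin)).resolve_left hdet
  exact hk (by rw [hb k, ha0, hb0]; ring)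
end
end
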